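/- If a finite simple graph G admits a Hamiltonian path (a path visiting every vertex of G exactly once), then μ(G) = ν(G). -/

import Mathlib

open Finset

section Defs
variable {V : Type*}

/-- A matching: a set of edges, pairwise non-adjacent. -/
def IsMatchingSet (G : SimpleGraph V) (M : Finset (Sym2 V)) : Prop :=
  ↑M ⊆ G.edgeSet ∧ ∀ e ∈ M, ∀ f ∈ M, e ≠ f → ∀ v : V, v ∈ e → v ∉ f

/-- A vertex is saturated by a matching if some edge of it is incident to the vertex. -/
def Saturates (M : Finset (Sym2 V)) (v : V) : Prop :=
  ∃ e ∈ M, v ∈ e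

/-- ν(G): maximum size of a matching. -/
noncomputable def nuG (G : SimpleGraph V) : ℕ :=
  sSup {n | ∃ M : Finset (Sym2 V), IsMatchingSet G M ∧ M.card = n}

/-- λ(G): maximum of |H| + |H'| over pairs of disjoint matchings. -/
noncomputable def lamG (G : SimpleGraph V) : ℕ :=
  sSup {n | ∃ H H' : Finset (Sym2 V), IsMatchingSet G H ∧ IsMatchingSet G H' ∧
    Disjoint H H' ∧ H.card + H'.card = n}

/-- Λ(G): set of pairs of disjoint matchings realizing λ(G). -/
def LambdaSet (G : SimpleGraph V) : Set (Finset (Sym2 V) × Finset (Sym2 V)) :=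
  {p | IsMatchingSet G p.1 ∧ IsMatchingSet G p.2 ∧ Disjoint p.1 p.2 ∧
    p.1.card + p.2.card = lamG G}

/-- μ(G): maximum of |H| over pairs (H, H') ∈ Λ(G). -/
noncomputable def muG (G : SimpleGraph V) : ℕ :=
  sSup {n | ∃ p ∈ LambdaSet G, p.1.card = n}

/-- Λ_μ(G): pairs in Λ(G) with |H| = μ(G). -/
def LambdaMuSet (G : SimpleGraph V) : Set (Finset (Sym2 V) × Finset (Sym2 V)) :=
  {p | p ∈ LambdaSet G ∧ p.1.card = muG G}

end Defs

namespace IsMatchingSet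

variable {V : Type*} {G : SimpleGraph V}

theorem empty : IsMatchingSet G ∅ := by simp [IsMatchingSet]

/-- Adding an edge with both ends unsaturated to a matching gives a matching. -/
theorem insert [DecidableEq V] {M : Finset (Sym2 V)} (hM : IsMatchingSet G M) {u v : V}
    (huv : G.Adj u v) (hu : ¬ Saturates M u) (hv : ¬ Saturates M v) :
    IsMatchingSet G (insert s(u, v) M) := by
  refine ⟨?_, ?_⟩
  · rw [coe_insert, Set.insert_subset_iff]
    exact ⟨huv, hM.1⟩
  · intro e he f hf hne w hwe hwf
    rw [mem_insert] at he hf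
    rcases he with rfl | he <;> rcases hf with rfl | hf
    · exact hne rfl
    · rcases Sym2.mem_iff.1 hwe with rfl | rfl
      · exact hu ⟨f, hf, hwf⟩
      · exact hv ⟨f, hf, hwf⟩
    · rcases Sym2.mem_iff.1 hwf with rfl | rfl
      · exact hu ⟨e, he, hwe⟩
      · exact hv ⟨e, he, hwe⟩
    · exact hM.2 e he f hf hne w hwe hwf

theorem two_mul_card_le [Fintype V] {M : Finset (Sym2 V)} (hM : IsMatchingSet G M) :
    2 * M.card ≤ Fintype.card V := by
  classical
  have hdisj : (M : Set (Sym2 V)).PairwiseDisjoint Sym2.toFinset := by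
    intro e he f hf hne
    refine Finset.disjoint_left.2 fun w hwe hwf => ?_
    exact hM.2 e he f hf hne w (Sym2.mem_toFinset.1 hwe) (Sym2.mem_toFinset.1 hwf)
  calc 2 * M.card = ∑ e ∈ M, e.toFinset.card := by
        rw [sum_congr rfl fun e he => Sym2.card_toFinset_of_not_isDiag e
          (G.not_isDiag_of_mem_edgeSet (hM.1 he)), sum_const, smul_eq_mul, mul_comm]
    _ = (M.biUnion Sym2.toFinset).card := (card_biUnion hdisj).symm
    _ ≤ Fintype.card V := card_le_univ _

end IsMatchingSet

/-- The edges of a path split alternately into two disjoint matchings. -/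
theorem SimpleGraph.Walk.IsPath.exists_disjoint_matchings {V : Type*} {G : SimpleGraph V}
    {u v : V} {p : G.Walk u v} (hp : p.IsPath) :
    ∃ A B : Finset (Sym2 V), IsMatchingSet G A ∧ IsMatchingSet G B ∧ Disjoint A B ∧
      A.card + B.card = p.length ∧ (∀ e ∈ A, e ∈ p.edges) ∧ (∀ e ∈ B, e ∈ p.edges) ∧
      ¬ Saturates B u := by
  classical
  induction p with
  | nil => exact ⟨∅, ∅, .empty, .empty, by simp [Saturates]⟩
  | @cons u w v huw p ih =>
    rw [SimpleGraph.Walk.cons_isPath_iff] at hp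
    obtain ⟨A, B, hA, hB, hAB, hcard, hAp, hBp, hw⟩ := ih hp.1
    have hu : ∀ e ∈ p.edges, u ∉ e := fun e he hue =>
      hp.2 (p.mem_support_of_mem_edges he hue)
    have huwA : s(u, w) ∉ A := fun hmem => hu _ (hAp _ hmem) (Sym2.mem_mk_left u w)
    have huwB : s(u, w) ∉ B := fun hmem => hu _ (hBp _ hmem) (Sym2.mem_mk_left u w)
    refine ⟨insert s(u, w) B, A, hB.insert huw (fun ⟨e, he, hue⟩ => hu e (hBp e he) hue) hw, hA,
      disjoint_insert_left.2 ⟨huwA, hAB.symm⟩, ?_, ?_, ?_, ?_⟩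
    · rw [card_insert_of_notMem huwB, SimpleGraph.Walk.length_cons]
      omega
    · intro e he
      rw [SimpleGraph.Walk.edges_cons, List.mem_cons]
      exact (mem_insert.1 he).imp id (hBp e)
    · intro e he
      rw [SimpleGraph.Walk.edges_cons, List.mem_cons]
      exact .inr (hAp e he)
    · exact fun ⟨e, he, hue⟩ => hu e (hAp e he) hue

theorem swap_mem_LambdaSet {V : Type*} {G : SimpleGraph V}
    {p : Finset (Sym2 V) × Finset (Sym2 V)} (hp : p ∈ LambdaSet G) : p.swap ∈ LambdaSet G :=
  ⟨hp.2.1, hp.1, hp.2.2.1.symm, (add_comm _ _).trans hp.2.2.2⟩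

section Extremal

variable {V : Type*} [Fintype V] (G : SimpleGraph V)

theorem exists_isMatchingSet_card_eq_nuG : ∃ M, IsMatchingSet G M ∧ M.card = nuG G := by
  refine Nat.sSup_mem (s := {n | ∃ M : Finset (Sym2 V), IsMatchingSet G M ∧ M.card = n})
    ⟨0, ∅, .empty, rfl⟩ ⟨Fintype.card V, ?_⟩
  rintro _ ⟨M, hM, rfl⟩
  have := hM.two_mul_card_le
  omega

variable {G} in
theorem IsMatchingSet.card_le_nuG {M : Finset (Sym2 V)} (hM : IsMatchingSet G M) :
    M.card ≤ nuG G := by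
  refine le_csSup ⟨Fintype.card V, ?_⟩ ⟨M, hM, rfl⟩
  rintro _ ⟨N, hN, rfl⟩
  have := hN.two_mul_card_le
  omega

theorem bddAbove_card_add_card : BddAbove {n | ∃ H H' : Finset (Sym2 V), IsMatchingSet G H ∧
    IsMatchingSet G H' ∧ Disjoint H H' ∧ H.card + H'.card = n} := by
  refine ⟨Fintype.card V, ?_⟩
  rintro _ ⟨H, H', hH, hH', -, rfl⟩
  have := hH.two_mul_card_le
  have := hH'.two_mul_card_le
  omega

theorem LambdaSet_nonempty : (LambdaSet G).Nonempty := by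
  have hne : {n | ∃ H H' : Finset (Sym2 V), IsMatchingSet G H ∧ IsMatchingSet G H' ∧
      Disjoint H H' ∧ H.card + H'.card = n}.Nonempty :=
    ⟨0, ∅, ∅, .empty, .empty, disjoint_empty_left _, rfl⟩
  obtain ⟨H, H', h⟩ := Nat.sSup_mem hne (bddAbove_card_add_card G)
  exact ⟨(H, H'), h⟩

variable {G}

theorem card_fst_le_muG {p : Finset (Sym2 V) × Finset (Sym2 V)} (hp : p ∈ LambdaSet G) :
    p.1.card ≤ muG G := by
  refine le_csSup ⟨nuG G, ?_⟩ ⟨p, hp, rfl⟩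
  rintro _ ⟨q, hq, rfl⟩
  exact hq.1.card_le_nuG

variable (G)

theorem muG_le_nuG : muG G ≤ nuG G := by
  obtain ⟨p, hp⟩ := LambdaSet_nonempty G
  refine csSup_le ⟨_, p, hp, rfl⟩ ?_
  rintro _ ⟨q, hq, rfl⟩
  exact hq.1.card_le_nuG

theorem lamG_le_two_mul_muG : lamG G ≤ 2 * muG G := by
  obtain ⟨p, hp⟩ := LambdaSet_nonempty G
  have h₁ := card_fst_le_muG hp
  have h₂ : p.2.card ≤ muG G := card_fst_le_muG (swap_mem_LambdaSet hp)
  have h₃ := hp.2.2.2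
  omega

theorem two_mul_nuG_le_card : 2 * nuG G ≤ Fintype.card V := by
  obtain ⟨M, hM, hcard⟩ := exists_isMatchingSet_card_eq_nuG G
  exact hcard ▸ hM.two_mul_card_le

variable {G} in
theorem SimpleGraph.Walk.IsPath.length_le_lamG {u v : V} {p : G.Walk u v} (hp : p.IsPath) :
    p.length ≤ lamG G := by
  obtain ⟨A, B, hA, hB, hAB, hcard, -⟩ := hp.exists_disjoint_matchings
  exact le_csSup (bddAbove_card_add_card G) ⟨A, B, hA, hB, hAB, hcard⟩

end Extremal

/-- If a finite graph admits a Hamiltonian path, then μ(G) = ν(G). -/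
theorem stmt10 {V : Type*} [Fintype V] (G : SimpleGraph V)
    (h : ∃ (u v : V) (p : G.Walk u v), p.IsPath ∧ ∀ w : V, w ∈ p.support) :
    muG G = nuG G := by
  classical
  obtain ⟨u, v, p, hp, hsupp⟩ := h
  have hcard : Fintype.card V ≤ p.length + 1 := by
    rw [← p.length_support, ← card_univ,
      ← eq_univ_of_forall fun w => List.mem_toFinset.2 (hsupp w)]
    exact p.support.toFinset_card_le
  have hlam := hp.length_le_lamG
  have hmu := lamG_le_two_mul_muG G
  have hnu := two_mul_nuG_le_card G
  have hle := muG_le_nuG G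
  omega
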